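/- arXiv:1210.1381 — 13 statements merged into one kernel-verified Lean document; each statement's English description precedes it below -/
import Mathlib

section
/- Let A be a left-right noncommutative Poisson algebra (NP^{lr}-algebra) over K. Then for all a, b, c, d ∈ A the identity [a,c]·[b,d] + [a,c]·[d,b] + [b,c]·[a,d] + [c,b]·[a,d] = 0 holds. -/
/-- In a left-right noncommutative Poisson algebra
(`NP^{lr}`-algebra) `A` over `K`, the identity
`[a,c]·[b,d] + [a,c]·[d,b] + [b,c]·[a,d] + [c,b]·[a,d] = 0` holds. -/
theorem np_lr_identity_2_1 {K A : Type*} [CommRing K] [NonUnitalRing A]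
    [Module K A] [IsScalarTower K A A] [SMulCommClass K A A]
    (br : A →ₗ[K] A →ₗ[K] A)
    (hl : ∀ a b c : A, br (a * b) c = a * br b c + br a c * b)
    (hr : ∀ a b c : A, br a (b * c) = b * br a c + br a b * c)
    (hleib : ∀ a b c : A, br a (br b c) = br (br a b) c - br (br a c) b) :
    ∀ a b c d : A,
      br a c * br b d + br a c * br d b + br b c * br a d + br c b * br a d = 0 := by
  intro a b c d
  have hs : ∀ x y z : A, br x (br y z + br z y) = 0 := fun x y z => by
    rw [map_add, hleib x y z, hleib x z y]
    abel
  have hexp : br (c * d) b + br b (c * d)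
      = c * (br d b + br b d) + (br c b + br b c) * d := by
    rw [hl, hr, mul_add, add_mul]
    abel
  have h := hs a (c * d) b
  rw [hexp, map_add, hr, hr, hs, hs, mul_zero, zero_mul, zero_add, add_zero,
    mul_add, add_mul] at h
  rw [← h]
  abel
end

section
/- Let A be a left-right algebra with bracket (AWB^{lr}) over K. Then for all a, b, c, d ∈ A the identity a·c·[b,d] + [a,c]·d·b = c·a·[b,d] + [a,c]·b·d holds. -/
/-- In a left-right algebra with bracket (`AWB^{lr}`) `A` over `K`,
the identity `a·c·[b,d] + [a,c]·d·b = c·a·[b,d] + [a,c]·b·d` holds. -/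
theorem awb_lr_identity_2_2 {K A : Type*} [CommRing K] [NonUnitalRing A]
    [Module K A] [IsScalarTower K A A] [SMulCommClass K A A]
    (br : A →ₗ[K] A →ₗ[K] A)
    (hl : ∀ a b c : A, br (a * b) c = a * br b c + br a c * b)
    (hr : ∀ a b c : A, br a (b * c) = b * br a c + br a b * c) :
    ∀ a b c d : A,
      a * c * br b d + br a c * d * b = c * a * br b d + br a c * b * d := by
  intro a b c d
  have h := hl a b (c * d)
  rw [hr (a * b) c d, hl a b d, hl a b c, hr b c d, hr a c d] at h
  simp only [mul_add, add_mul, ← mul_assoc] at h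
  rw [← sub_eq_zero] at h ⊢
  rw [← neg_eq_zero, ← h]
  abel
end

section
/- Let A be a right noncommutative Poisson algebra (NP^r-algebra) over K. Then for all a, b, c, d ∈ A the identity [[a,c]·d, b] = [[a,c],b]·d − [a,c]·[b,d] − [b,c]·[a,d] + c·[[a,d],b] − [c·[a,d],b] holds. -/
/-- In a right noncommutative Poisson algebra (`NP^r`-algebra) `A`
over `K`, the identity
`[[a,c]·d, b] = [[a,c],b]·d − [a,c]·[b,d] − [b,c]·[a,d] + c·[[a,d],b] − [c·[a,d],b]`
holds. -/
theorem np_r_identity_2_4 {K A : Type*} [CommRing K] [NonUnitalRing A]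
    [Module K A] [IsScalarTower K A A] [SMulCommClass K A A]
    (br : A →ₗ[K] A →ₗ[K] A)
    (hr : ∀ a b c : A, br a (b * c) = b * br a c + br a b * c)
    (hleib : ∀ a b c : A, br a (br b c) = br (br a b) c - br (br a c) b) :
    ∀ a b c d : A,
      br (br a c * d) b =
        br (br a c) b * d - br a c * br b d - br b c * br a d
          + c * br (br a d) b - br (c * br a d) b := by
  intro a b c d
  have h := hleib a b (c * d)
  simp only [hr, map_add, LinearMap.add_apply, hleib a b, mul_sub, sub_mul] at h
  rw [← sub_eq_zero] at h ⊢
  rw [← h]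
  abel
end

section
/- Let A be a left-right algebra with bracket (AWB^{lr}) over K. Then for all a, b, c ∈ A the identity [a·b, c] − [a, c·b] + [b·c, a] − [b, a·c] + [c·a, b] − [c, b·a] = 0 holds. -/
/-- In a left-right algebra with bracket (`AWB^{lr}`) `A` over `K`,
the identity
`[a·b, c] − [a, c·b] + [b·c, a] − [b, a·c] + [c·a, b] − [c, b·a] = 0` holds. -/
theorem awb_lr_identity_2_6 {K A : Type*} [CommRing K] [NonUnitalRing A]
    [Module K A] [IsScalarTower K A A] [SMulCommClass K A A]
    (br : A →ₗ[K] A →ₗ[K] A)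
    (hl : ∀ a b c : A, br (a * b) c = a * br b c + br a c * b)
    (hr : ∀ a b c : A, br a (b * c) = b * br a c + br a b * c) :
    ∀ a b c : A,
      br (a * b) c - br a (c * b) + br (b * c) a - br b (a * c)
        + br (c * a) b - br c (b * a) = 0 := by
  intro a b c
  simp only [hl, hr]
  abel
end

section
/- Let A be a right noncommutative Poisson algebra (NP^r-algebra) over K. Then for all a, b, c, d ∈ A the identity [[a,c]·d, b] = −[b, [a,c]·d] + [[b,a],c]·d − [[b,c],a]·d − [a, [b,c]·d] + [[a,b],c]·d + [[a,d], c·b] − [[a,d], c]·b − [c·[a,d], b] holds. -/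
/-- In a right noncommutative Poisson algebra (`NP^r`-algebra) `A`
over `K`, the identity
`[[a,c]·d, b] = −[b, [a,c]·d] + [[b,a],c]·d − [[b,c],a]·d − [a, [b,c]·d]
  + [[a,b],c]·d + [[a,d], c·b] − [[a,d], c]·b − [c·[a,d], b]` holds. -/
theorem np_r_identity_2_7 {K A : Type*} [CommRing K] [NonUnitalRing A]
    [Module K A] [IsScalarTower K A A] [SMulCommClass K A A]
    (br : A →ₗ[K] A →ₗ[K] A)
    (hr : ∀ a b c : A, br a (b * c) = b * br a c + br a b * c)
    (hleib : ∀ a b c : A, br a (br b c) = br (br a b) c - br (br a c) b) :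
    ∀ a b c d : A,
      br (br a c * d) b =
        -(br b (br a c * d)) + br (br b a) c * d - br (br b c) a * d
          - br a (br b c * d) + br (br a b) c * d + br (br a d) (c * b)
          - br (br a d) c * b - br (c * br a d) b := by
  intro a b c d
  have key : br (br a c * d) b + br (c * br a d) b =
      c * br (br a d) b - br a c * br b d + br (br a b) c * d - br a (br b c * d) := by
    have h₁ : br (br a (c * d)) b = br (br a b) (c * d) - br a (br b (c * d)) := by
      rw [hleib a b (c * d)]; abel
    rw [hr a c d, hr (br a b) c d, hr b c d, map_add, map_add, LinearMap.add_apply,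
      hr a c (br b d), hleib a b d, mul_sub] at h₁
    rw [add_comm, h₁]
    abel
  have h₂ : br b (br a c * d) =
      br a c * br b d + (br (br b a) c * d - br (br b c) a * d) := by
    rw [hr, hleib b a c, sub_mul]
  rw [eq_sub_of_add_eq key, h₂, hr (br a d) c b]
  abel
end

section
/- Let A be an associative (not necessarily commutative or unital) K-algebra and let D : A → A be a square-zero derivation, i.e. a K-linear map with D∘D = 0 and D(a·b) = (Da)·b + a·(Db) for all a, b ∈ A. Then A with the bracket [a,b] = a·(Db) − (Db)·a is a left noncommutative Poisson algebra (NP^l-algebra): this bracket is K-bilinear and satisfies the left Poisson identity and the Leibniz identity. -/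
/-- The bracket `[a,b] = a·(Db) − (Db)·a` associated to a linear map `D`. -/
def derBracketL {K A : Type*} [CommRing K] [NonUnitalRing A] [Module K A]
    (D : A →ₗ[K] A) (a b : A) : A := a * D b - D b * a

/-- If `D : A → A` is a square-zero derivation of an associative
`K`-algebra `A`, then `A` with the bracket `[a,b] = a·(Db) − (Db)·a` is an
`NP^l`-algebra: the bracket is `K`-bilinear and satisfies the left Poisson
identity and the Leibniz identity. -/
theorem squareZeroDer_np_l {K A : Type*} [CommRing K] [NonUnitalRing A]
    [Module K A] [IsScalarTower K A A] [SMulCommClass K A A]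
    (D : A →ₗ[K] A)
    (hder : ∀ a b : A, D (a * b) = D a * b + a * D b)
    (hsq : ∀ a : A, D (D a) = 0) :
    (∀ a a' b : A, derBracketL D (a + a') b = derBracketL D a b + derBracketL D a' b) ∧
    (∀ (k : K) (a b : A), derBracketL D (k • a) b = k • derBracketL D a b) ∧
    (∀ a b b' : A, derBracketL D a (b + b') = derBracketL D a b + derBracketL D a b') ∧
    (∀ (k : K) (a b : A), derBracketL D a (k • b) = k • derBracketL D a b) ∧
    (∀ a b c : A,
      derBracketL D (a * b) c = a * derBracketL D b c + derBracketL D a c * b) ∧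
    (∀ a b c : A,
      derBracketL D a (derBracketL D b c) =
        derBracketL D (derBracketL D a b) c - derBracketL D (derBracketL D a c) b) := by
  refine ⟨fun a a' b => ?_, fun k a b => ?_, fun a b b' => ?_, fun k a b => ?_,
    fun a b c => ?_, fun a b c => ?_⟩ <;> unfold derBracketL
  · noncomm_ring
  · rw [smul_mul_assoc, mul_smul_comm, smul_sub]
  · rw [map_add]
    noncomm_ring
  · rw [map_smul, smul_mul_assoc, mul_smul_comm, smul_sub]
  · noncomm_ring
  · simp only [map_sub, hder, hsq, mul_zero, zero_mul, add_zero, zero_add]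
    noncomm_ring
end

section
/- Let A be an associative (not necessarily commutative or unital) K-algebra with the property that a·b·c = b·a·c = a·c·b for all a, b, c ∈ A, and let D : A → A be a square-zero derivation. Then A with the bracket [a,b] = a·(Db) − (Db)·a is a left-right noncommutative Poisson algebra (NP^{lr}-algebra): this bracket is K-bilinear and satisfies the left Poisson identity, the right Poisson identity and the Leibniz identity. -/
/-- The bracket `[a,b] = a·(Db) − (Db)·a` associated to a linear map `D`. -/
def derBracketL9 {K A : Type*} [CommRing K] [NonUnitalRing A] [Module K A]
    (D : A →ₗ[K] A) (a b : A) : A := a * D b - D b * a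

/-- Let `A` be an associative `K`-algebra with
`a·b·c = b·a·c = a·c·b` for all `a, b, c`, and let `D` be a square-zero
derivation.  Then `A` with the bracket `[a,b] = a·(Db) − (Db)·a` is an
`NP^{lr}`-algebra: the bracket is `K`-bilinear and satisfies the left Poisson,
right Poisson and Leibniz identities. -/
theorem squareZeroDer_np_lr {K A : Type*} [CommRing K] [NonUnitalRing A]
    [Module K A] [IsScalarTower K A A] [SMulCommClass K A A]
    (hcomm₁ : ∀ a b c : A, a * b * c = b * a * c)
    (hcomm₂ : ∀ a b c : A, a * b * c = a * c * b)
    (D : A →ₗ[K] A)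
    (hder : ∀ a b : A, D (a * b) = D a * b + a * D b)
    (hsq : ∀ a : A, D (D a) = 0) :
    (∀ a a' b : A, derBracketL9 D (a + a') b = derBracketL9 D a b + derBracketL9 D a' b) ∧
    (∀ (k : K) (a b : A), derBracketL9 D (k • a) b = k • derBracketL9 D a b) ∧
    (∀ a b b' : A, derBracketL9 D a (b + b') = derBracketL9 D a b + derBracketL9 D a b') ∧
    (∀ (k : K) (a b : A), derBracketL9 D a (k • b) = k • derBracketL9 D a b) ∧
    (∀ a b c : A,
      derBracketL9 D (a * b) c = a * derBracketL9 D b c + derBracketL9 D a c * b) ∧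
    (∀ a b c : A,
      derBracketL9 D a (b * c) = b * derBracketL9 D a c + derBracketL9 D a b * c) ∧
    (∀ a b c : A,
      derBracketL9 D a (derBracketL9 D b c) =
        derBracketL9 D (derBracketL9 D a b) c - derBracketL9 D (derBracketL9 D a c) b) := by
  have mul_comm_left : ∀ a b c : A, a * (b * c - c * b) = 0 := fun a b c => by
    rw [mul_sub, ← mul_assoc, ← mul_assoc, hcomm₂, sub_self]
  have mul_comm_right : ∀ a b c : A, (a * b - b * a) * c = 0 := fun a b c => by
    rw [sub_mul, hcomm₁, sub_self]
  have cyclic : ∀ a b c : A, a * b * c = c * a * b := fun a b c => by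
    rw [hcomm₂, hcomm₁]
  have bracket_mul_left : ∀ a b c : A, derBracketL9 D (a * b) c = 0 := fun a b c => by
    rw [derBracketL9, ← mul_assoc, cyclic, sub_self]
  have bracket_mul_right : ∀ a b c : A, derBracketL9 D a (b * c) = 0 := fun a b c => by
    rw [derBracketL9, hder, mul_add, add_mul, ← mul_assoc, ← mul_assoc, cyclic (D b), cyclic b,
      sub_self]
  have sub_left : ∀ a a' b : A,
      derBracketL9 D (a - a') b = derBracketL9 D a b - derBracketL9 D a' b := fun a a' b => by
    simp only [derBracketL9, sub_mul, mul_sub]; abel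
  have sub_right : ∀ a b b' : A,
      derBracketL9 D a (b - b') = derBracketL9 D a b - derBracketL9 D a b' := fun a b b' => by
    simp only [derBracketL9, map_sub, sub_mul, mul_sub]; abel
  refine ⟨fun a a' b => ?_, fun k a b => ?_, fun a b b' => ?_, fun k a b => ?_,
    fun a b c => ?_, fun a b c => ?_, fun a b c => ?_⟩
  · simp only [derBracketL9, add_mul, mul_add]; abel
  · simp only [derBracketL9, smul_mul_assoc, mul_smul_comm, smul_sub]
  · simp only [derBracketL9, map_add, add_mul, mul_add]; abel
  · simp only [derBracketL9, map_smul, smul_mul_assoc, mul_smul_comm, smul_sub]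
  · rw [bracket_mul_left, derBracketL9, derBracketL9, mul_comm_left, mul_comm_right, add_zero]
  · rw [bracket_mul_right, derBracketL9, derBracketL9, mul_comm_left, mul_comm_right, add_zero]
  · have bracket_bracket_right : derBracketL9 D a (derBracketL9 D b c) = 0 := by
      rw [derBracketL9.eq_def D b c, sub_right, bracket_mul_right, bracket_mul_right, sub_self]
    have bracket_bracket_left : ∀ x y z : A, derBracketL9 D (derBracketL9 D x y) z = 0 :=
      fun x y z => by
        rw [derBracketL9.eq_def D x y, sub_left, bracket_mul_left, bracket_mul_left, sub_self]
    rw [bracket_bracket_right, bracket_bracket_left, bracket_bracket_left, sub_self]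
end

section
/- Let A be an associative (not necessarily commutative or unital) K-algebra and let D : A → A be a K-linear map satisfying (Da)·b − b·(Da) = a·(Db) − (Db)·a for all a, b ∈ A. Then A with the bracket [a,b] = (Da)·b − b·(Da) is a left-right algebra with bracket (AWB^{lr}): this bracket is K-bilinear and satisfies both the left Poisson identity and the right Poisson identity. -/
/-- The bracket `[a,b] = (Da)·b − b·(Da)` associated to a linear map `D`. -/
def linBracketR12 {K A : Type*} [CommRing K] [NonUnitalRing A] [Module K A]
    (D : A →ₗ[K] A) (a b : A) : A := D a * b - b * D a

/-- If `D : A → A` is a `K`-linear map on an associative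
`K`-algebra `A` satisfying `(Da)·b − b·(Da) = a·(Db) − (Db)·a` for all `a, b`,
then `A` with the bracket `[a,b] = (Da)·b − b·(Da)` is an `AWB^{lr}`: the
bracket is `K`-bilinear and satisfies both the left and the right Poisson
identities. -/
theorem linearMapSym_awb_lr {K A : Type*} [CommRing K] [NonUnitalRing A]
    [Module K A] [IsScalarTower K A A] [SMulCommClass K A A]
    (D : A →ₗ[K] A)
    (hsym : ∀ a b : A, D a * b - b * D a = a * D b - D b * a) :
    (∀ a a' b : A, linBracketR12 D (a + a') b = linBracketR12 D a b + linBracketR12 D a' b) ∧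
    (∀ (k : K) (a b : A), linBracketR12 D (k • a) b = k • linBracketR12 D a b) ∧
    (∀ a b b' : A, linBracketR12 D a (b + b') = linBracketR12 D a b + linBracketR12 D a b') ∧
    (∀ (k : K) (a b : A), linBracketR12 D a (k • b) = k • linBracketR12 D a b) ∧
    (∀ a b c : A,
      linBracketR12 D (a * b) c = a * linBracketR12 D b c + linBracketR12 D a c * b) ∧
    (∀ a b c : A,
      linBracketR12 D a (b * c) = b * linBracketR12 D a c + linBracketR12 D a b * c) := by
  refine ⟨fun a a' b => ?_, fun k a b => ?_, fun a b b' => ?_, fun k a b => ?_,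
    fun a b c => ?_, fun a b c => ?_⟩ <;> simp only [linBracketR12]
  · simp only [map_add, add_mul, mul_add]
    abel
  · simp only [map_smul, smul_mul_assoc, mul_smul_comm, smul_sub]
  · simp only [add_mul, mul_add]
    abel
  · simp only [smul_mul_assoc, mul_smul_comm, smul_sub]
  · simp only [hsym, mul_sub, sub_mul, mul_assoc]
    abel
  · simp only [mul_sub, sub_mul, mul_assoc]
    abel
end

section
/- Let A be an associative (not necessarily commutative or unital) K-algebra, and let D : A → A be a square-zero derivation satisfying (Da)·b − b·(Da) = a·(Db) − (Db)·a for all a, b ∈ A. Then A with the bracket [a,b] = (Da)·b − b·(Da) is a left-right noncommutative Poisson algebra (NP^{lr}-algebra): this bracket is K-bilinear and satisfies the left Poisson identity, the right Poisson identity and the Leibniz identity. -/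
/-- The bracket `[a,b] = (Da)·b − b·(Da)` associated to a linear map `D`. -/
def linBracketR13 {K A : Type*} [CommRing K] [NonUnitalRing A] [Module K A]
    (D : A →ₗ[K] A) (a b : A) : A := D a * b - b * D a

/-- If `D : A → A` is a square-zero derivation of an associative
`K`-algebra `A` satisfying `(Da)·b − b·(Da) = a·(Db) − (Db)·a` for all `a, b`,
then `A` with the bracket `[a,b] = (Da)·b − b·(Da)` is an `NP^{lr}`-algebra:
the bracket is `K`-bilinear and satisfies the left Poisson, right Poisson and
Leibniz identities. -/
theorem squareZeroDerSym_np_lr {K A : Type*} [CommRing K] [NonUnitalRing A]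
    [Module K A] [IsScalarTower K A A] [SMulCommClass K A A]
    (D : A →ₗ[K] A)
    (hder : ∀ a b : A, D (a * b) = D a * b + a * D b)
    (hsq : ∀ a : A, D (D a) = 0)
    (hsym : ∀ a b : A, D a * b - b * D a = a * D b - D b * a) :
    (∀ a a' b : A, linBracketR13 D (a + a') b = linBracketR13 D a b + linBracketR13 D a' b) ∧
    (∀ (k : K) (a b : A), linBracketR13 D (k • a) b = k • linBracketR13 D a b) ∧
    (∀ a b b' : A, linBracketR13 D a (b + b') = linBracketR13 D a b + linBracketR13 D a b') ∧
    (∀ (k : K) (a b : A), linBracketR13 D a (k • b) = k • linBracketR13 D a b) ∧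
    (∀ a b c : A,
      linBracketR13 D (a * b) c = a * linBracketR13 D b c + linBracketR13 D a c * b) ∧
    (∀ a b c : A,
      linBracketR13 D a (b * c) = b * linBracketR13 D a c + linBracketR13 D a b * c) ∧
    (∀ a b c : A,
      linBracketR13 D a (linBracketR13 D b c) =
        linBracketR13 D (linBracketR13 D a b) c - linBracketR13 D (linBracketR13 D a c) b) := by
  have hcomm : ∀ a b : A, D a * D b - D b * D a = 0 := fun a b => by
    simpa [hsq] using (hsym (D a) b).symm
  have hD : ∀ a b : A, D (linBracketR13 D a b) = 0 := fun a b => by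
    simpa [linBracketR13, hder, hsq] using hcomm a b
  refine ⟨fun a a' b => ?_, fun k a b => ?_, fun a b b' => ?_, fun k a b => ?_,
    fun a b c => ?_, fun a b c => ?_, fun a b c => ?_⟩
  · simp only [linBracketR13, map_add]
    noncomm_ring
  · simp only [linBracketR13, map_smul, smul_mul_assoc, mul_smul_comm, smul_sub]
  · simp only [linBracketR13]
    noncomm_ring
  · simp only [linBracketR13, smul_mul_assoc, mul_smul_comm, smul_sub]
  · simp only [linBracketR13, hsym]
    noncomm_ring
  · simp only [linBracketR13]
    noncomm_ring
  · have hleft : linBracketR13 D a (linBracketR13 D b c) = 0 := by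
      rw [linBracketR13, hsym, hD, mul_zero, zero_mul, sub_zero]
    have hright : ∀ x y z : A, linBracketR13 D (linBracketR13 D x y) z = 0 := fun x y z => by
      rw [linBracketR13, hD, mul_zero, zero_mul, sub_zero]
    rw [hleft, hright, hright, sub_zero]
end

section
/- Let (A, ⊣, ⊢) be an associative dialgebra over K. Then A with the product a·b = a ⊢ b and the bracket [a,b] = a ⊢ b − b ⊣ a is a right algebra with bracket (AWB^r): the product is associative, the bracket is K-bilinear, and the right Poisson identity [a, b·c] = b·[a,c] + [a,b]·c holds for all a, b, c ∈ A. -/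
/-- The bracket `[a,b] = a ⊢ b − b ⊣ a` on an associative dialgebra. -/
def diaBracketR {K A : Type*} [CommRing K] [AddCommGroup A] [Module K A]
    (dashv vdash : A →ₗ[K] A →ₗ[K] A) (a b : A) : A := vdash a b - dashv b a

/-- Any associative dialgebra `(A, ⊣, ⊢)` over `K`, with the
product `a·b = a ⊢ b` and the bracket `[a,b] = a ⊢ b − b ⊣ a`, is an `AWB^r`:
the product is associative, the bracket is `K`-bilinear and the right Poisson
identity `[a, b·c] = b·[a,c] + [a,b]·c` holds. -/
theorem dialgebra_awb_r {K A : Type*} [CommRing K] [AddCommGroup A] [Module K A]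
    (dashv vdash : A →ₗ[K] A →ₗ[K] A)
    (h1 : ∀ a b c : A, dashv (dashv a b) c = dashv a (dashv b c))
    (h2 : ∀ a b c : A, dashv a (dashv b c) = dashv a (vdash b c))
    (h3 : ∀ a b c : A, dashv (vdash a b) c = vdash a (dashv b c))
    (h4 : ∀ a b c : A, vdash (dashv a b) c = vdash (vdash a b) c)
    (h5 : ∀ a b c : A, vdash (vdash a b) c = vdash a (vdash b c)) :
    (∀ a b c : A, vdash (vdash a b) c = vdash a (vdash b c)) ∧
    (∀ a a' b : A, diaBracketR dashv vdash (a + a') b =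
        diaBracketR dashv vdash a b + diaBracketR dashv vdash a' b) ∧
    (∀ (k : K) (a b : A), diaBracketR dashv vdash (k • a) b =
        k • diaBracketR dashv vdash a b) ∧
    (∀ a b b' : A, diaBracketR dashv vdash a (b + b') =
        diaBracketR dashv vdash a b + diaBracketR dashv vdash a b') ∧
    (∀ (k : K) (a b : A), diaBracketR dashv vdash a (k • b) =
        k • diaBracketR dashv vdash a b) ∧
    (∀ a b c : A, diaBracketR dashv vdash a (vdash b c) =
        vdash b (diaBracketR dashv vdash a c) + vdash (diaBracketR dashv vdash a b) c) := by
  refine ⟨h5, fun a a' b => ?_, fun k a b => ?_, fun a b b' => ?_, fun k a b => ?_,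
    fun a b c => ?_⟩ <;> unfold diaBracketR
  · simp only [map_add, LinearMap.add_apply]
    abel
  · simp only [map_smul, LinearMap.smul_apply, smul_sub]
  · simp only [map_add, LinearMap.add_apply]
    abel
  · simp only [map_smul, LinearMap.smul_apply, smul_sub]
  · simp only [map_sub, LinearMap.sub_apply, h3, h4, h5]
    abel
end

section
/- Let (A, ⊣, ⊢) be an associative dialgebra over K. Then A with the product a·b = a ⊢ b and the bracket [a,b] = a ⊣ b − b ⊢ a is a left algebra with bracket (AWB^l): the product is associative, the bracket is K-bilinear, and the left Poisson identity [a·b, c] = a·[b,c] + [a,c]·b holds for all a, b, c ∈ A. -/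
/-- The bracket `[a,b] = a ⊣ b − b ⊢ a` on an associative dialgebra. -/
def diaBracketL {K A : Type*} [CommRing K] [AddCommGroup A] [Module K A]
    (dashv vdash : A →ₗ[K] A →ₗ[K] A) (a b : A) : A := dashv a b - vdash b a

/-- Any associative dialgebra `(A, ⊣, ⊢)` over `K`, with the
product `a·b = a ⊢ b` and the bracket `[a,b] = a ⊣ b − b ⊢ a`, is an `AWB^l`:
the product is associative, the bracket is `K`-bilinear and the left Poisson
identity `[a·b, c] = a·[b,c] + [a,c]·b` holds. -/
theorem dialgebra_awb_l {K A : Type*} [CommRing K] [AddCommGroup A] [Module K A]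
    (dashv vdash : A →ₗ[K] A →ₗ[K] A)
    (h1 : ∀ a b c : A, dashv (dashv a b) c = dashv a (dashv b c))
    (h2 : ∀ a b c : A, dashv a (dashv b c) = dashv a (vdash b c))
    (h3 : ∀ a b c : A, dashv (vdash a b) c = vdash a (dashv b c))
    (h4 : ∀ a b c : A, vdash (dashv a b) c = vdash (vdash a b) c)
    (h5 : ∀ a b c : A, vdash (vdash a b) c = vdash a (vdash b c)) :
    (∀ a b c : A, vdash (vdash a b) c = vdash a (vdash b c)) ∧
    (∀ a a' b : A, diaBracketL dashv vdash (a + a') b =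
        diaBracketL dashv vdash a b + diaBracketL dashv vdash a' b) ∧
    (∀ (k : K) (a b : A), diaBracketL dashv vdash (k • a) b =
        k • diaBracketL dashv vdash a b) ∧
    (∀ a b b' : A, diaBracketL dashv vdash a (b + b') =
        diaBracketL dashv vdash a b + diaBracketL dashv vdash a b') ∧
    (∀ (k : K) (a b : A), diaBracketL dashv vdash a (k • b) =
        k • diaBracketL dashv vdash a b) ∧
    (∀ a b c : A, diaBracketL dashv vdash (vdash a b) c =
        vdash a (diaBracketL dashv vdash b c) + vdash (diaBracketL dashv vdash a c) b) := by
  refine ⟨h5, ?_, ?_, ?_, ?_, ?_⟩ <;> intros <;> simp only [diaBracketL]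
  · simp only [map_add, LinearMap.add_apply]
    abel
  · simp only [map_smul, LinearMap.smul_apply, smul_sub]
  · simp only [map_add, LinearMap.add_apply]
    abel
  · simp only [map_smul, LinearMap.smul_apply, smul_sub]
  · simp only [map_sub, LinearMap.sub_apply, h3, h4, h5]
    abel
end

section
/- Let (A, ⊣, ⊢) be an associative dialgebra over K satisfying the additional condition a ⊢ b − b ⊣ a = a ⊣ b − b ⊢ a for all a, b ∈ A. Then A with the product a·b = a ⊢ b and the bracket [a,b] = a ⊢ b − b ⊣ a is a left-right noncommutative Poisson algebra (NP^{lr}-algebra): the product is associative, the bracket is K-bilinear, and the left Poisson identity, the right Poisson identity and the Leibniz identity all hold. -/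
/-- The bracket `[a,b] = a ⊢ b − b ⊣ a` on an associative dialgebra. -/
def diaBracket16 {K A : Type*} [CommRing K] [AddCommGroup A] [Module K A]
    (dashv vdash : A →ₗ[K] A →ₗ[K] A) (a b : A) : A := vdash a b - dashv b a

/-- Any associative dialgebra `(A, ⊣, ⊢)` over `K` satisfying
`a ⊢ b − b ⊣ a = a ⊣ b − b ⊢ a`, with the product `a·b = a ⊢ b` and the bracket
`[a,b] = a ⊢ b − b ⊣ a`, is an `NP^{lr}`-algebra: the product is associative,
the bracket is `K`-bilinear, and the left Poisson, right Poisson and Leibniz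
identities hold. -/
theorem dialgebra_np_lr {K A : Type*} [CommRing K] [AddCommGroup A] [Module K A]
    (dashv vdash : A →ₗ[K] A →ₗ[K] A)
    (h1 : ∀ a b c : A, dashv (dashv a b) c = dashv a (dashv b c))
    (h2 : ∀ a b c : A, dashv a (dashv b c) = dashv a (vdash b c))
    (h3 : ∀ a b c : A, dashv (vdash a b) c = vdash a (dashv b c))
    (h4 : ∀ a b c : A, vdash (dashv a b) c = vdash (vdash a b) c)
    (h5 : ∀ a b c : A, vdash (vdash a b) c = vdash a (vdash b c))
    (hsym : ∀ a b : A, vdash a b - dashv b a = dashv a b - vdash b a) :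
    (∀ a b c : A, vdash (vdash a b) c = vdash a (vdash b c)) ∧
    (∀ a a' b : A, diaBracket16 dashv vdash (a + a') b =
        diaBracket16 dashv vdash a b + diaBracket16 dashv vdash a' b) ∧
    (∀ (k : K) (a b : A), diaBracket16 dashv vdash (k • a) b =
        k • diaBracket16 dashv vdash a b) ∧
    (∀ a b b' : A, diaBracket16 dashv vdash a (b + b') =
        diaBracket16 dashv vdash a b + diaBracket16 dashv vdash a b') ∧
    (∀ (k : K) (a b : A), diaBracket16 dashv vdash a (k • b) =
        k • diaBracket16 dashv vdash a b) ∧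
    (∀ a b c : A, diaBracket16 dashv vdash (vdash a b) c =
        vdash a (diaBracket16 dashv vdash b c) + vdash (diaBracket16 dashv vdash a c) b) ∧
    (∀ a b c : A, diaBracket16 dashv vdash a (vdash b c) =
        vdash b (diaBracket16 dashv vdash a c) + vdash (diaBracket16 dashv vdash a b) c) ∧
    (∀ a b c : A, diaBracket16 dashv vdash a (diaBracket16 dashv vdash b c) =
        diaBracket16 dashv vdash (diaBracket16 dashv vdash a b) c
          - diaBracket16 dashv vdash (diaBracket16 dashv vdash a c) b) := by
  -- by `hsym`, the defect `x ⊢ y - x ⊣ y` is antisymmetric in `x` and `y`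
  have hleft : ∀ a b c : A, vdash c (vdash a b) - dashv c (vdash a b) =
      vdash a (vdash c b) - vdash a (dashv c b) := by
    intro a b c
    have e₁ := hsym c (vdash a b)
    have e₂ := congrArg (vdash a) (hsym c b)
    simp only [map_sub, h3, h5] at e₁ e₂
    grind
  have hmid : ∀ a b c : A, vdash c (vdash a b) - vdash c (dashv a b) =
      vdash a (dashv b c) - dashv a (vdash b c) := by
    intro a b c
    have e := hsym c (vdash a b - dashv a b)
    simp only [map_sub, LinearMap.sub_apply, h1, h2, h3, h4, h5] at e
    grind
  have hanti : ∀ a b c : A, vdash a (vdash b c) - vdash a (dashv c b) =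
      vdash a (dashv b c) - vdash a (vdash c b) := by
    intro a b c
    simpa only [map_sub] using congrArg (vdash a) (hsym b c)
  unfold diaBracket16
  refine ⟨h5, ?_, ?_, ?_, ?_, ?_, ?_, ?_⟩
  · intro a a' b
    simp only [map_add, LinearMap.add_apply]
    abel
  · intro k a b
    simp only [map_smul, LinearMap.smul_apply, smul_sub]
  · intro a b b'
    simp only [map_add, LinearMap.add_apply]
    abel
  · intro k a b
    simp only [map_smul, LinearMap.smul_apply, smul_sub]
  · intro a b c
    simp only [map_sub, LinearMap.sub_apply, h4, h5]
    have := hleft a b c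
    grind
  · intro a b c
    simp only [map_sub, LinearMap.sub_apply, h3, h4, h5]
    abel
  · intro a b c
    simp only [map_sub, LinearMap.sub_apply, h1, h2, h3, h4, h5]
    have e₁ := hleft a b c
    have e₂ := hleft a c b
    have e₃ := hleft c a b
    have e₄ := hmid a b c
    have e₅ := hleft b c a
    have e₆ := hanti b c a
    have e₇ := hanti c a b
    clear h1 h2 h3 h4 h5 hsym hleft hmid hanti
    grind
end

section
/- Let P be a right algebra with bracket (AWB^r) over a field K and let M be a representation of P. For n ≥ 1, the maps α'^n : Hom_K(P^{⊗n}, M) → Hom_K(P^{⊗n}, M^e) form a homomorphism of cochain complexes from the Hochschild complex of P with coefficients in M to the Hochschild complex of P with coefficients in M^e; that is, ∂_H^{e,n} ∘ α'^n = α'^{n+1} ∘ ∂_H^n for all n ≥ 1. -/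
open scoped BigOperators

/-- The Hochschild coboundary `∂_H^n` on `n`-cochains with values in an abelian
group `N` equipped with left and right `P`-actions `l` and `r` (for `N = M` these
are the dot actions, for `N = M^e = Hom(P,M)` the induced actions
`(p·g)(q) = p·g(q)`, `(g·p)(q) = g(q)·p`):
`∂_H^n(f)(p₁,…,p_{n+1}) = (−1)^{n+1} { p₁·f(p₂,…,p_{n+1})
  + Σ_{i=1}^n (−1)^i f(p₁,…,p_i·p_{i+1},…,p_{n+1})
  + (−1)^{n+1} f(p₁,…,p_n)·p_{n+1} }`. -/
def hochschildCoboundary {P N : Type*} [NonUnitalRing P] [AddCommGroup N]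
    (l : P → N → N) (r : N → P → N) (n : ℕ)
    (f : (Fin n → P) → N) : (Fin (n + 1) → P) → N :=
  fun p =>
    ((-1 : ℤ) ^ (n + 1)) •
      (l (p 0) (f fun i => p i.succ)
        + ∑ i ∈ Finset.range n, ((-1 : ℤ) ^ (i + 1)) •
            f (fun j => if (j : ℕ) < i then p j.castSucc
                 else if (j : ℕ) = i then p j.castSucc * p j.succ
                 else p j.succ)
        + ((-1 : ℤ) ^ (n + 1)) • r (f fun i => p i.castSucc) (p (Fin.last n)))

/-- The map `α'^n : C^n_H(P,M) → C^n_H(P,M^e)` (elements of `M^e = Hom(P,M)`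
are evaluated at `q`, so the values are recorded as functions `P → M`):
`α'^1(f)(p₁)(p₂) = [f(p₂),p₁] + [p₂,f(p₁)] − f([p₂,p₁])` and, for `n > 1`,
`α'^n(f)(p₁,…,p_n)(p_{n+1}) = [p_{n+1}, f(p₁,…,p_n)]
  − Σ_{i=1}^n f(p₁,…,[p_{n+1},p_i],…,p_n)`. -/
def alphaPrime {P M : Type*} [NonUnitalRing P] [AddCommGroup M]
    (bp : P → P → P) (bpm : P → M → M) (bmp : M → P → M)
    (n : ℕ) (f : (Fin n → P) → M) : (Fin n → P) → P → M :=
  fun p q =>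
    (bpm q (f p) - ∑ i : Fin n, f (Function.update p i (bp q (p i))))
      + (if h : n = 1 then bmp (f fun _ => q) (p ⟨0, by omega⟩) else 0)

/-- The tuple `(p₁,…,p_i·p_{i+1},…,p_{n+1})`, with the product in the (zero-based) position `i`. -/
def mergeAt {P : Type*} [Mul P] {n : ℕ} (i : ℕ) (p : Fin (n + 1) → P) : Fin n → P :=
  fun j => if (j : ℕ) < i then p j.castSucc
    else if (j : ℕ) = i then p j.castSucc * p j.succ
    else p j.succ

/-- The derivation-like part of `alphaPrime`, without the correction term in degree one. -/
def bracketCochain {P M : Type*} [AddCommGroup M]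
    (bp : P → P → P) (bpm : P → M → M) (n : ℕ) (f : (Fin n → P) → M) : (Fin n → P) → P → M :=
  fun p q => bpm q (f p) - ∑ i : Fin n, f (Function.update p i (bp q (p i)))

section mergeAt

variable {P : Type*} [Mul P] {n : ℕ} (I : Fin n) (p : Fin (n + 1) → P) (x : P)

theorem mergeAt_self : mergeAt I p I = p I.castSucc * p I.succ := by
  simp [mergeAt]

theorem mergeAt_update_succ :
    mergeAt I (Function.update p I.succ x)
      = Function.update (mergeAt I p) I (p I.castSucc * x) := by
  funext j
  simp only [mergeAt, Function.update_apply, Fin.ext_iff, Fin.val_castSucc, Fin.val_succ]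
  split_ifs <;> try first | rfl | omega
  all_goals grind

theorem mergeAt_update_castSucc :
    mergeAt I (Function.update p I.castSucc x)
      = Function.update (mergeAt I p) I (x * p I.succ) := by
  funext j
  simp only [mergeAt, Function.update_apply, Fin.ext_iff, Fin.val_castSucc, Fin.val_succ]
  split_ifs <;> try first | rfl | omega
  all_goals grind

theorem mergeAt_update_succAbove {j : Fin n} (hj : j ≠ I) :
    mergeAt I (Function.update p (I.succ.succAbove j) x) = Function.update (mergeAt I p) j x := by
  have hj' : (j : ℕ) ≠ I := fun h => hj (Fin.ext h)
  funext k
  simp only [mergeAt, Function.update_apply, Fin.ext_iff, Fin.succAbove, Fin.lt_def,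
    Fin.val_castSucc, Fin.val_succ]
  split_ifs <;> try first | rfl | omega
  all_goals simp_all <;> omega

theorem mergeAt_succAbove {j : Fin n} (hj : j ≠ I) :
    mergeAt I p j = p (I.succ.succAbove j) := by
  have hj' : (j : ℕ) ≠ I := fun h => hj (Fin.ext h)
  simp only [mergeAt, Fin.succAbove, Fin.lt_def, Fin.val_castSucc, Fin.val_succ]
  split_ifs <;> first | rfl | omega

end mergeAt

/-- Applying a derivation to each entry of a tuple in turn commutes with merging two entries. -/
theorem sum_mergeAt_update {K P M : Type*} [Semiring K] [NonUnitalRing P] [Module K P]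
    [AddCommGroup M] [Module K M] {n : ℕ} (f : MultilinearMap K (fun _ : Fin n => P) M)
    (δ : P → P) (hδ : ∀ b c, δ (b * c) = b * δ c + δ b * c) (I : Fin n) (p : Fin (n + 1) → P) :
    ∑ k, f (mergeAt I (Function.update p k (δ (p k))))
      = ∑ j, f (Function.update (mergeAt I p) j (δ (mergeAt I p j))) := by
  rw [Fin.sum_univ_succAbove _ I.succ, mergeAt_update_succ]
  have key : ∀ j, f (Function.update (mergeAt I p) j (δ (mergeAt I p j)))
      = (if j = I then f (Function.update (mergeAt I p) I (p I.castSucc * δ (p I.succ))) else 0)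
        + f (mergeAt I (Function.update p (I.succ.succAbove j) (δ (p (I.succ.succAbove j))))) := by
    intro j
    by_cases hj : j = I
    · subst hj
      have h : j.succ.succAbove j = j.castSucc :=
        Fin.succAbove_of_castSucc_lt _ _ j.castSucc_lt_succ
      rw [if_pos rfl, h, mergeAt_update_castSucc, mergeAt_self, hδ, f.map_update_add]
    · rw [if_neg hj, zero_add, mergeAt_update_succAbove I p _ hj, mergeAt_succAbove I p hj]
  simp only [key, Finset.sum_add_distrib, Finset.sum_ite_eq', Finset.mem_univ, if_true]

theorem hochschildCoboundary_eq {P N : Type*} [NonUnitalRing P] [AddCommGroup N]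
    (l : P → N → N) (r : N → P → N) (n : ℕ) (f : (Fin n → P) → N) (p : Fin (n + 1) → P) :
    hochschildCoboundary l r n f p
      = ((-1 : ℤ) ^ (n + 1)) •
        (l (p 0) (f (Fin.tail p)) + ∑ i : Fin n, ((-1 : ℤ) ^ ((i : ℕ) + 1)) • f (mergeAt i p)
          + ((-1 : ℤ) ^ (n + 1)) • r (f (Fin.init p)) (p (Fin.last n))) := by
  unfold hochschildCoboundary
  rw [Finset.sum_range]
  rfl

theorem hochschildCoboundary_add {P N : Type*} [NonUnitalRing P] [AddCommGroup N]
    (l : P → N → N) (r : N → P → N) (hl : ∀ p a b, l p (a + b) = l p a + l p b)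
    (hr : ∀ p a b, r (a + b) p = r a p + r b p) (n : ℕ) (f g : (Fin n → P) → N) :
    hochschildCoboundary l r n (f + g)
      = hochschildCoboundary l r n f + hochschildCoboundary l r n g := by
  funext p
  simp only [Pi.add_apply, hochschildCoboundary_eq, hl, hr, smul_add, Finset.sum_add_distrib]
  abel

theorem sum_left_action_tail_update {P M : Type*} [AddCommMonoid M] {n : ℕ}
    (pm : P → M → M) (f : (Fin n → P) → M) (δ : P → P)
    (p : Fin (n + 1) → P) :
    ∑ k, pm (Function.update p k (δ (p k)) 0) (f (Fin.tail (Function.update p k (δ (p k)))))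
      = pm (δ (p 0)) (f (Fin.tail p))
        + ∑ j, pm (p 0) (f (Function.update (Fin.tail p) j (δ (Fin.tail p j)))) := by
  rw [Fin.sum_univ_succ]
  simp [Fin.tail_update_zero, Fin.tail_update_succ, Fin.tail,
    Function.update_of_ne (Fin.succ_ne_zero _).symm]

theorem sum_right_action_init_update {P M : Type*} [AddCommMonoid M] {n : ℕ}
    (mp : M → P → M) (f : (Fin n → P) → M) (δ : P → P)
    (p : Fin (n + 1) → P) :
    ∑ k, mp (f (Fin.init (Function.update p k (δ (p k)))))
        (Function.update p k (δ (p k)) (Fin.last n))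
      = ∑ j, mp (f (Function.update (Fin.init p) j (δ (Fin.init p j)))) (p (Fin.last n))
        + mp (f (Fin.init p)) (δ (p (Fin.last n))) := by
  rw [Fin.sum_univ_castSucc]
  simp [Fin.init_update_last, Fin.init_update_castSucc, Fin.init, (Fin.castSucc_lt_last _).ne']

theorem hochschildCoboundary_bracketCochain {K P M : Type*} [CommSemiring K]
    [NonUnitalRing P] [Module K P] [AddCommGroup M] [Module K M]
    (bp : P → P → P) (hrP : ∀ a b c : P, bp a (b * c) = b * bp a c + bp a b * c)
    (pm : P →ₗ[K] M →ₗ[K] M) (mp : M →ₗ[K] P →ₗ[K] M) (bpm : P →ₗ[K] M →ₗ[K] M)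
    (hrep2 : ∀ (p₁ p₂ : P) (m : M),
      bpm p₁ (pm p₂ m) = pm p₂ (bpm p₁ m) + pm (bp p₁ p₂) m)
    (hrep3 : ∀ (p₁ p₂ : P) (m : M),
      bpm p₁ (mp m p₂) = mp m (bp p₁ p₂) + mp (bpm p₁ m) p₂)
    (n : ℕ) (f : MultilinearMap K (fun _ : Fin n => P) M) :
    hochschildCoboundary (fun p g q => pm p (g q)) (fun g p q => mp (g q) p) n
        (bracketCochain bp (fun p m => bpm p m) n f)
      = bracketCochain bp (fun p m => bpm p m) (n + 1)
          (hochschildCoboundary (fun p m => pm p m) (fun m p => mp m p) n f) := by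
  funext p q
  have hmid : ∑ k, ∑ i : Fin n, ((-1 : ℤ) ^ ((i : ℕ) + 1)) •
        f (mergeAt i (Function.update p k (bp q (p k))))
      = ∑ i : Fin n, ((-1 : ℤ) ^ ((i : ℕ) + 1)) •
        ∑ j, f (Function.update (mergeAt i p) j (bp q (mergeAt i p j))) := by
    rw [Finset.sum_comm]
    refine Finset.sum_congr rfl fun i _ => ?_
    rw [← Finset.smul_sum, sum_mergeAt_update f (bp q) (hrP q)]
  simp only [bracketCochain, hochschildCoboundary_eq, Pi.smul_apply, Pi.add_apply,
    Finset.sum_apply, map_zsmul, ← Finset.smul_sum, ← smul_sub]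
  congr 1
  simp only [Finset.sum_add_distrib, ← Finset.smul_sum, hmid,
    sum_left_action_tail_update (fun a m => pm a m),
    sum_right_action_init_update (fun m a => mp m a),
    map_add, map_sub, map_sum, map_zsmul, hrep2, hrep3, LinearMap.sub_apply, LinearMap.sum_apply,
    smul_sub, smul_add, Finset.sum_sub_distrib]
  abel

/-- Let `P` be a right algebra with bracket (`AWB^r`) over a
field `K` and `M` a representation of `P`.  For every `n ≥ 1` and every
multilinear `f : Hom_K(P^{⊗n}, M)`, we have
`∂_H^{e,n}(α'^n(f)) = α'^{n+1}(∂_H^n(f))`; that is, the maps `α'^*` form a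
homomorphism of cochain complexes from the Hochschild complex of `P` with
coefficients in `M` to the one with coefficients in `M^e`. -/
theorem alphaPrime_cochain_map {K P M : Type*} [Field K]
    [NonUnitalRing P] [Module K P] [IsScalarTower K P P] [SMulCommClass K P P]
    [AddCommGroup M] [Module K M]
    -- the bracket of the `AWB^r` structure on `P`
    (bp : P →ₗ[K] P →ₗ[K] P)
    (hrP : ∀ a b c : P, bp a (b * c) = b * bp a c + bp a b * c)
    -- the action maps `p·m`, `m·p`, `[p,m]`, `[m,p]` of the representation `M`
    (pm : P →ₗ[K] M →ₗ[K] M) (mp : M →ₗ[K] P →ₗ[K] M)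
    (bpm : P →ₗ[K] M →ₗ[K] M) (bmp : M →ₗ[K] P →ₗ[K] M)
    -- `M` is a `P`-bimodule for the dot actions
    (hbi1 : ∀ (p p' : P) (m : M), pm p (mp m p') = mp (pm p m) p')
    (hbi2 : ∀ (p p' : P) (m : M), mp (mp m p) p' = mp m (p * p'))
    (hbi3 : ∀ (p p' : P) (m : M), pm (p * p') m = pm p (pm p' m))
    -- the right Poisson-type conditions of the representation
    (hrep1 : ∀ (m : M) (p₁ p₂ : P),
      bmp m (p₁ * p₂) = pm p₁ (bmp m p₂) + mp (bmp m p₁) p₂)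
    (hrep2 : ∀ (p₁ p₂ : P) (m : M),
      bpm p₁ (pm p₂ m) = pm p₂ (bpm p₁ m) + pm (bp p₁ p₂) m)
    (hrep3 : ∀ (p₁ p₂ : P) (m : M),
      bpm p₁ (mp m p₂) = mp m (bp p₁ p₂) + mp (bpm p₁ m) p₂)
    (n : ℕ) (hn : 1 ≤ n)
    (f : MultilinearMap K (fun _ : Fin n => P) M) :
    hochschildCoboundary (fun p g q => pm p (g q)) (fun g p q => mp (g q) p) n
        (alphaPrime (fun a b => bp a b) (fun p m => bpm p m) (fun m p => bmp m p) n
          (fun x => f x))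
      = alphaPrime (fun a b => bp a b) (fun p m => bpm p m) (fun m p => bmp m p) (n + 1)
          (hochschildCoboundary (fun p m => pm p m) (fun m p => mp m p) n
            (fun x => f x)) := by
  have hsplit : ∀ (k : ℕ) (g : (Fin k → P) → M),
      alphaPrime (fun a b => bp a b) (fun p m => bpm p m) (fun m p => bmp m p) k g
        = bracketCochain (fun a b => bp a b) (fun p m => bpm p m) k g
          + fun p q => if h : k = 1 then bmp (g fun _ => q) (p ⟨0, by omega⟩) else 0 :=
    fun _ _ => rfl
  rw [hsplit, hsplit, hochschildCoboundary_add _ _ (fun _ _ _ => funext fun _ => map_add _ _ _)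
      (fun _ _ _ => funext fun _ => by simp),
    hochschildCoboundary_bracketCochain _ hrP pm mp bpm hrep2 hrep3 n f]
  congr 1
  funext p q
  rw [dif_neg (by omega)]
  by_cases h : n = 1
  · subst h
    simp [hochschildCoboundary, hrep1]
  · simp [hochschildCoboundary, h]
end
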